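/- arXiv:1501.01519 — 2 statements merged into one kernel-verified Lean document; each statement's English description precedes it below -/
import Mathlib

section
/- Let n ≥ 3, set 2* := 2n/(n−2), and let Θ be a nonempty bounded open subset of ℝⁿ. Let a ∈ C¹(closure Θ) and b, c ∈ C⁰(closure Θ) be strictly positive on closure Θ. Let S := inf{ (∫_{ℝⁿ}|∇u|²dx) / (∫_{ℝⁿ}|u|^{2*}dx)^{2/2*} : u ∈ C_c^∞(ℝⁿ), u ≠ 0 } and κ^{a,c} := (min_{x ∈ closure Θ} a(x)^{n/2}/c(x)^{(n−2)/2})·(1/n)·S^{n/2}. Then for every λ ∈ ℝ and every ε > 0 there exists u ∈ C_c^∞(Θ) with u ≠ 0 such that ∫_Θ a(x)|∇u(x)|²dx − λ∫_Θ b(x)u(x)²dx > 0 and (1/n)·( (∫_Θ a(x)|∇u(x)|²dx − λ∫_Θ b(x)u(x)²dx) / (∫_Θ c(x)|u(x)|^{2*}dx)^{2/2*} )^{n/2} < κ^{a,c} + ε. -/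
open MeasureTheory

noncomputable section

/-- `u ∈ C_c^∞(s)`: `u` is smooth with compact support contained in `s`. -/
def IsTestFun {E : Type*} [NormedAddCommGroup E] [NormedSpace ℝ E]
    (s : Set E) (u : E → ℝ) : Prop :=
  ContDiff ℝ (⊤ : ℕ∞) u ∧ HasCompactSupport u ∧ tsupport u ⊆ s

/-- The best Sobolev constant
`S = inf{ ∫|∇u|² / (∫|u|^{2*})^{2/2*} : u ∈ C_c^∞(ℝⁿ), u ≠ 0 }` with `2* = 2n/(n−2)`. -/
def SobolevS (n : ℕ) : ℝ :=
  sInf { r : ℝ | ∃ u : EuclideanSpace ℝ (Fin n) → ℝ,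
    IsTestFun Set.univ u ∧ u ≠ 0 ∧
    r = (∫ x, ‖gradient u x‖ ^ 2) /
        (∫ x, |u x| ^ (2 * (n : ℝ) / ((n : ℝ) - 2))) ^ (2 / (2 * (n : ℝ) / ((n : ℝ) - 2))) }

open Filter Topology in
lemma aux_change {n : ℕ} (w G : EuclideanSpace ℝ (Fin n) → ℝ) (x₁ : EuclideanSpace ℝ (Fin n))
    {μ : ℝ} (hμ : 0 < μ) :
    ∫ x, w x * G (μ⁻¹ • (x - x₁)) = μ ^ n * ∫ y, w (x₁ + μ • y) * G y := by
  have h1 := integral_sub_right_eq_self (μ := (volume : Measure (EuclideanSpace ℝ (Fin n))))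
    (fun x => w (x₁ + μ • (μ⁻¹ • x)) * G (μ⁻¹ • x)) x₁
  have h2 := Measure.integral_comp_inv_smul_of_nonneg
    (volume : Measure (EuclideanSpace ℝ (Fin n))) (fun y => w (x₁ + μ • y) * G y) hμ.le
  rw [h2] at h1
  simp only [finrank_euclideanSpace, Fintype.card_fin, smul_eq_mul] at h1
  rw [← h1]
  congr 1
  ext x
  rw [smul_inv_smul₀ hμ.ne']
  simp

open Filter Topology in
lemma aux_lim {n : ℕ} (w G : EuclideanSpace ℝ (Fin n) → ℝ) (x₁ : EuclideanSpace ℝ (Fin n))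
    (hw : Measurable w) (M : ℝ) (hM : ∀ x, |w x| ≤ M) (hc : ContinuousAt w x₁)
    (hG : Integrable G) :
    Tendsto (fun μ : ℝ => ∫ y, w (x₁ + μ • y) * G y) (𝓝[>] 0) (𝓝 (w x₁ * ∫ y, G y)) := by
  rw [← integral_const_mul]
  refine tendsto_integral_filter_of_dominated_convergence (fun y => M * |G y|) ?_ ?_ ?_ ?_
  · refine Eventually.of_forall fun μ => ?_
    refine AEStronglyMeasurable.mul ?_ hG.1
    exact (hw.comp (by fun_prop)).aestronglyMeasurable
  · refine Eventually.of_forall fun μ => Eventually.of_forall fun y => ?_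
    rw [Real.norm_eq_abs, abs_mul]
    exact mul_le_mul_of_nonneg_right (hM _) (abs_nonneg _)
  · exact hG.abs.const_mul M
  · refine Eventually.of_forall fun y => ?_
    refine Tendsto.mul_const _ ?_
    have h : Tendsto (fun μ : ℝ => x₁ + μ • y) (𝓝[>] 0) (𝓝 x₁) := by
      have : Continuous (fun μ : ℝ => x₁ + μ • y) := by fun_prop
      have h := this.tendsto 0
      simp only [zero_smul, add_zero] at h
      exact h.mono_left nhdsWithin_le_nhds
    exact hc.tendsto.comp h

open Filter Topology in
/-- set-integral version -/
lemma aux_set {n : ℕ} (Θ : Set (EuclideanSpace ℝ (Fin n))) (hΘo : IsOpen Θ)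
    (hΘb : Bornology.IsBounded Θ) (w G : EuclideanSpace ℝ (Fin n) → ℝ)
    (hw : ContinuousOn w (closure Θ))
    (x₁ : EuclideanSpace ℝ (Fin n)) (hx₁ : x₁ ∈ Θ) (hG : Integrable G) :
    ∃ A : ℝ → ℝ, (∀ μ > 0, ∫ x in Θ, w x * G (μ⁻¹ • (x - x₁)) = μ ^ n * A μ) ∧
      Tendsto A (𝓝[>] 0) (𝓝 (w x₁ * ∫ y, G y)) := by
  have hK : IsCompact (closure Θ) := hΘb.isCompact_closure
  obtain ⟨M, hM⟩ := hK.exists_bound_of_continuousOn hw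
  refine ⟨fun μ => ∫ y, (Θ.indicator w) (x₁ + μ • y) * G y, ?_, ?_⟩
  · intro μ hμ
    rw [← aux_change _ _ _ hμ, ← integral_indicator hΘo.measurableSet]
    congr 1
    ext x
    by_cases hx : x ∈ Θ <;> simp [hx]
  · have h1 : Θ.indicator w x₁ = w x₁ := by simp [hx₁]
    rw [← h1]
    refine aux_lim _ _ _ ?_ M ?_ ?_ hG
    · classical
      have := ContinuousOn.measurable_piecewise (f := w) (g := 0) (s := Θ)
        (hw.mono subset_closure) continuous_zero.continuousOn hΘo.measurableSet
      rwa [Set.piecewise_eq_indicator] at this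
    · intro x
      by_cases hx : x ∈ Θ
      · simpa [hx] using hM x (subset_closure hx)
      · simpa [hx] using (norm_nonneg _).trans (hM x₁ (subset_closure hx₁))
    · have h2 : ContinuousAt w x₁ := (hw.mono subset_closure).continuousAt (hΘo.mem_nhds hx₁)
      refine h2.congr ?_
      filter_upwards [hΘo.mem_nhds hx₁] with x hx
      simp [hx]

lemma aux_norm_grad {n : ℕ} (v : EuclideanSpace ℝ (Fin n) → ℝ) (x : EuclideanSpace ℝ (Fin n)) :
    ‖gradient v x‖ = ‖fderiv ℝ v x‖ := by
  simp [gradient]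

lemma aux_grad {n : ℕ} (v : EuclideanSpace ℝ (Fin n) → ℝ) (x₁ x : EuclideanSpace ℝ (Fin n))
    (μ : ℝ) :
    ‖gradient (fun x => v (μ⁻¹ • (x - x₁))) x‖ ^ 2
      = (μ⁻¹) ^ 2 * ‖gradient v (μ⁻¹ • (x - x₁))‖ ^ 2 := by
  rw [aux_norm_grad, aux_norm_grad]
  have h : fderiv ℝ (fun x => v (μ⁻¹ • (x - x₁))) x = μ⁻¹ • fderiv ℝ v (μ⁻¹ • (x - x₁)) := by
    rw [fderiv_comp_sub (𝕜 := ℝ) (f := fun y => v (μ⁻¹ • y)) x₁, fderiv_comp_smul]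
  rw [h, norm_smul, mul_pow, Real.norm_eq_abs, sq_abs]

lemma aux_int_grad {n : ℕ} (v : EuclideanSpace ℝ (Fin n) → ℝ) (hv : IsTestFun Set.univ v) :
    Continuous (fun x => ‖gradient v x‖ ^ 2) ∧ Integrable (fun x => ‖gradient v x‖ ^ 2) := by
  simp only [aux_norm_grad]
  have h1 : Continuous (fun x => ‖fderiv ℝ v x‖ ^ 2) :=
    ((hv.1.continuous_fderiv (by simp)).norm).pow 2
  refine ⟨h1, h1.integrable_of_hasCompactSupport ?_⟩
  exact (hv.2.1.fderiv ℝ).comp_left (g := fun z => ‖z‖ ^ 2) (by simp)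

lemma aux_grad_pos {n : ℕ} (hn : 3 ≤ n) (v : EuclideanSpace ℝ (Fin n) → ℝ)
    (hv : IsTestFun Set.univ v) (hv0 : v ≠ 0) : 0 < ∫ x, ‖gradient v x‖ ^ 2 := by
  obtain ⟨hc, hi⟩ := aux_int_grad v hv
  have : ∃ x, ‖gradient v x‖ ^ 2 ≠ 0 := by
    by_contra! hcon
    apply hv0
    have hz : ∀ x, fderiv ℝ v x = 0 := fun x => by
      have := hcon x
      rw [aux_norm_grad] at this
      simpa using this
    have hconst := is_const_of_fderiv_eq_zero (𝕜 := ℝ) (hv.1.differentiable (by simp)) hz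
    have : Nonempty (Fin n) := ⟨⟨0, by omega⟩⟩
    have : NoncompactSpace (EuclideanSpace ℝ (Fin n)) :=
      NormedSpace.noncompactSpace ℝ _
    have hex : ∃ x, v x = 0 := by
      by_contra! h
      have : tsupport v = Set.univ := by
        apply Set.eq_univ_of_forall
        intro x
        exact subset_tsupport v (h x)
      have h3 := hv.2.1
      rw [HasCompactSupport, this] at h3
      exact noncompact_univ _ h3
    obtain ⟨x, hx⟩ := hex
    ext y
    simp [hconst y x, hx]
  obtain ⟨x, hx⟩ := this
  exact integral_pos_of_integrable_nonneg_nonzero hc hi (fun x => by positivity) hx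

lemma aux_p {n : ℕ} (v : EuclideanSpace ℝ (Fin n) → ℝ) (hv : IsTestFun Set.univ v)
    (p : ℝ) (hp : 0 < p) : Continuous (fun x => |v x| ^ p) ∧ Integrable (fun x => |v x| ^ p) := by
  have h1 : Continuous (fun x => |v x| ^ p) :=
    hv.1.continuous.abs.rpow_const (fun _ => Or.inr hp.le)
  refine ⟨h1, h1.integrable_of_hasCompactSupport ?_⟩
  exact hv.2.1.comp_left (g := fun z => |z| ^ p) (by simp [hp.ne'])

lemma aux_p_pos {n : ℕ} (v : EuclideanSpace ℝ (Fin n) → ℝ) (hv : IsTestFun Set.univ v)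
    (hv0 : v ≠ 0) (p : ℝ) (hp : 0 < p) : 0 < ∫ x, |v x| ^ p := by
  obtain ⟨x, hx⟩ := Function.ne_iff.1 hv0
  obtain ⟨h1, h2⟩ := aux_p v hv p hp
  refine integral_pos_of_integrable_nonneg_nonzero (x := x) h1 h2 (fun x => by positivity) ?_
  have : 0 < |v x| := abs_pos.2 hx
  positivity

open Filter Topology in
lemma aux_testfun {n : ℕ} (Θ : Set (EuclideanSpace ℝ (Fin n))) (hΘo : IsOpen Θ)
    (x₁ : EuclideanSpace ℝ (Fin n)) (hx₁ : x₁ ∈ Θ) (v : EuclideanSpace ℝ (Fin n) → ℝ)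
    (hv : IsTestFun Set.univ v) :
    ∀ᶠ μ : ℝ in 𝓝[>] 0, IsTestFun Θ (fun x => v (μ⁻¹ • (x - x₁))) := by
  obtain ⟨r, hr, hrΘ⟩ := Metric.nhds_basis_closedBall.mem_iff.1 (hΘo.mem_nhds hx₁)
  obtain ⟨R, hR⟩ := hv.2.1.isBounded.subset_closedBall 0
  have hlim : Tendsto (fun μ : ℝ => μ * R) (𝓝[>] 0) (𝓝 0) := by
    have : Continuous (fun μ : ℝ => μ * R) := by fun_prop
    have h := this.tendsto 0
    simp only [zero_mul] at h
    exact h.mono_left nhdsWithin_le_nhds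
  filter_upwards [self_mem_nhdsWithin, hlim.eventually (gt_mem_nhds hr)] with μ hμ hμR
  have hμ : 0 < μ := hμ
  have hsub : Function.support (fun x => v (μ⁻¹ • (x - x₁))) ⊆ Metric.closedBall x₁ r := by
    intro x hx
    have h1 := hR (subset_tsupport v (show μ⁻¹ • (x - x₁) ∈ Function.support v from hx))
    rw [mem_closedBall_zero_iff, norm_smul, Real.norm_eq_abs, abs_of_pos (inv_pos.2 hμ),
      inv_mul_le_iff₀ hμ] at h1
    rw [mem_closedBall_iff_norm]
    linarith
  refine ⟨hv.1.comp (by fun_prop), ?_, ?_⟩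
  · exact HasCompactSupport.of_support_subset_isCompact (isCompact_closedBall x₁ r) hsub
  · exact (closure_minimal hsub Metric.isClosed_closedBall).trans hrΘ

lemma aux_exists_test (n : ℕ) : ∃ v : EuclideanSpace ℝ (Fin n) → ℝ,
    IsTestFun Set.univ v ∧ v ≠ 0 := by
  let f : ContDiffBump (0 : EuclideanSpace ℝ (Fin n)) := ⟨1, 2, by norm_num, by norm_num⟩
  refine ⟨f, ⟨f.contDiff, f.hasCompactSupport, Set.subset_univ _⟩, fun h => ?_⟩
  have h1 : f 0 = 1 := f.one_of_mem_closedBall (by simp [f])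
  rw [h] at h1
  simp at h1

open Filter Topology in
lemma aux_inf (s : Set ℝ) (hs : s.Nonempty) (hb : BddBelow s) (F : ℝ → ℝ) (hF : Continuous F)
    (t : ℝ) (ht : F (sInf s) < t) : ∃ r ∈ s, F r < t := by
  have h := mem_closure_iff_frequently.1 (csInf_mem_closure hs hb)
  have h2 : ∀ᶠ r in 𝓝 (sInf s), F r < t := hF.continuousAt.eventually (gt_mem_nhds ht)
  obtain ⟨r, h3, h4⟩ := (h.and_eventually h2).exists
  exact ⟨r, h3, h4⟩

lemma aux_scale (n : ℕ) (hn : 3 ≤ n) (p : ℝ) (hp : p = 2 * (n : ℝ) / ((n : ℝ) - 2))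
    (μ : ℝ) (hμ : 0 < μ) (C : ℝ) (hC : 0 ≤ C) :
    (μ ^ n * C) ^ (2 / p) = μ ^ n * (μ⁻¹) ^ 2 * C ^ (2 / p) := by
  have hn' : (3 : ℝ) ≤ n := by exact_mod_cast hn
  rw [Real.mul_rpow (by positivity) hC]
  congr 1
  rw [← Real.rpow_natCast, ← Real.rpow_mul hμ.le]
  have : (n : ℝ) * (2 / p) = n - 2 := by
    rw [hp]
    have : (n : ℝ) - 2 ≠ 0 := by linarith
    field_simp
  rw [this, Real.rpow_sub hμ, Real.rpow_ofNat, Real.rpow_natCast]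
  field_simp

lemma aux_v2 {n : ℕ} (v : EuclideanSpace ℝ (Fin n) → ℝ) (hv : IsTestFun Set.univ v) :
    Integrable (fun x => v x ^ 2) := by
  have h := (aux_p v hv 2 (by norm_num)).2
  simpa only [Real.rpow_ofNat, sq_abs] using h

lemma aux_main (n : ℕ) (hn : 3 ≤ n) (p : ℝ) (hp : p = 2 * (n : ℝ) / ((n : ℝ) - 2))
    (Θ : Set (EuclideanSpace ℝ (Fin n))) (hΘo : IsOpen Θ)
    (hΘb : Bornology.IsBounded Θ)
    (a b c : EuclideanSpace ℝ (Fin n) → ℝ)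
    (ha : ContinuousOn a (closure Θ)) (hb : ContinuousOn b (closure Θ))
    (hc : ContinuousOn c (closure Θ))
    (hapos : ∀ x ∈ closure Θ, 0 < a x)
    (hcpos : ∀ x ∈ closure Θ, 0 < c x) (lam t r : ℝ) (x₁ : EuclideanSpace ℝ (Fin n))
    (hx₁ : x₁ ∈ Θ) (v : EuclideanSpace ℝ (Fin n) → ℝ) (hv : IsTestFun Set.univ v) (hv0 : v ≠ 0)
    (hr : r = (∫ x, ‖gradient v x‖ ^ 2) / (∫ x, |v x| ^ p) ^ (2 / p))
    (hx₁lt : (a x₁ ^ ((n : ℝ) / 2) / c x₁ ^ (((n : ℝ) - 2) / 2)) * ((1 : ℝ) / n) *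
      r ^ ((n : ℝ) / 2) < t) :
    ∃ u : EuclideanSpace ℝ (Fin n) → ℝ,
      IsTestFun Θ u ∧ u ≠ 0 ∧
      0 < (∫ x in Θ, a x * ‖gradient u x‖ ^ 2) - lam * ∫ x in Θ, b x * u x ^ 2 ∧
      (1 : ℝ) / n *
        (((∫ x in Θ, a x * ‖gradient u x‖ ^ 2) - lam * ∫ x in Θ, b x * u x ^ 2) /
            (∫ x in Θ, c x * |u x| ^ p) ^ (2 / p)) ^ ((n : ℝ) / 2) < t := by
  have hn' : (3 : ℝ) ≤ n := by exact_mod_cast hn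
  have hn0 : (0 : ℝ) < n := by linarith
  have hn2 : (0 : ℝ) < (n : ℝ) - 2 := by linarith
  have hp0 : 0 < p := by rw [hp]; positivity
  have hg0 := aux_grad_pos hn v hv hv0
  have hq0 := aux_p_pos v hv hv0 p hp0
  have ha1 := hapos x₁ (subset_closure hx₁)
  have hc1 := hcpos x₁ (subset_closure hx₁)
  obtain ⟨A, hA, hAl⟩ := aux_set Θ hΘo hΘb a (fun x => ‖gradient v x‖ ^ 2) ha x₁ hx₁
    (aux_int_grad v hv).2
  have hv2 : Integrable (fun x => v x ^ 2) := aux_v2 v hv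
  obtain ⟨B, hB, hBl⟩ := aux_set Θ hΘo hΘb b (fun x => v x ^ 2) hb x₁ hx₁ hv2
  obtain ⟨C, hC, hCl⟩ := aux_set Θ hΘo hΘb c (fun x => |v x| ^ p) hc x₁ hx₁ (aux_p v hv p hp0).2
  generalize (∫ x, ‖gradient v x‖ ^ 2) = Ig at *
  generalize (∫ x, |v x| ^ p) = Iq at *
  have hμ2 : Filter.Tendsto (fun μ : ℝ => μ ^ 2) (nhdsWithin 0 (Set.Ioi 0)) (nhds 0) := by
    have : Continuous (fun μ : ℝ => μ ^ 2) := by fun_prop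
    have h := this.tendsto 0
    simp only [ne_eq, OfNat.ofNat_ne_zero, not_false_eq_true, zero_pow] at h
    exact h.mono_left nhdsWithin_le_nhds
  have hNl : Filter.Tendsto (fun μ : ℝ => A μ - lam * (μ ^ 2 * B μ))
      (nhdsWithin 0 (Set.Ioi 0)) (nhds (a x₁ * Ig)) := by
    have := hAl.sub ((hμ2.mul hBl).const_mul lam)
    simpa using this
  have hDl : Filter.Tendsto (fun μ : ℝ => C μ ^ (2 / p))
      (nhdsWithin 0 (Set.Ioi 0)) (nhds ((c x₁ * Iq) ^ (2 / p))) :=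
    hCl.rpow_const (Or.inr (by positivity))
  have hQl : Filter.Tendsto
      (fun μ : ℝ => (1 : ℝ) / n * ((A μ - lam * (μ ^ 2 * B μ)) / C μ ^ (2 / p)) ^ ((n : ℝ) / 2))
      (nhdsWithin 0 (Set.Ioi 0))
      (nhds ((1 : ℝ) / n * (a x₁ * Ig / (c x₁ * Iq) ^ (2 / p)) ^ ((n : ℝ) / 2))) := by
    refine Filter.Tendsto.const_mul _ ?_
    refine (hNl.div hDl ?_).rpow_const (Or.inr (by positivity))
    positivity
  have hlimval : (1 : ℝ) / n * (a x₁ * Ig / (c x₁ * Iq) ^ (2 / p)) ^ ((n : ℝ) / 2)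
      = (a x₁ ^ ((n : ℝ) / 2) / c x₁ ^ (((n : ℝ) - 2) / 2)) * ((1 : ℝ) / n) * r ^ ((n : ℝ) / 2) := by
    have e1 : a x₁ * Ig / (c x₁ * Iq) ^ (2 / p) = (a x₁ / c x₁ ^ (2 / p)) * r := by
      rw [hr, Real.mul_rpow hc1.le hq0.le, mul_div_mul_comm]
    have hr0 : 0 ≤ r := by rw [hr]; positivity
    have e2 : (2 / p) * ((n : ℝ) / 2) = ((n : ℝ) - 2) / 2 := by
      rw [hp]; field_simp
    rw [e1, Real.mul_rpow (by positivity) hr0, Real.div_rpow ha1.le (by positivity),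
      ← Real.rpow_mul hc1.le, e2]
    ring
  rw [hlimval] at hQl
  have hNpos : 0 < a x₁ * Ig := by positivity
  have hCpos : 0 < c x₁ * Iq := by positivity
  obtain ⟨μ, ⟨⟨⟨hN, hCμ⟩, hQ⟩, hT⟩, hμ⟩ := ((((hNl.eventually (lt_mem_nhds hNpos)).and
    (hCl.eventually (lt_mem_nhds hCpos))).and (hQl.eventually (gt_mem_nhds hx₁lt))).and
    (aux_testfun Θ hΘo x₁ hx₁ v hv)).and self_mem_nhdsWithin |>.exists
  have hμ : 0 < μ := hμ
  have hnum : (∫ x in Θ, a x * ‖gradient (fun x => v (μ⁻¹ • (x - x₁))) x‖ ^ 2)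
      - lam * ∫ x in Θ, b x * v (μ⁻¹ • (x - x₁)) ^ 2
      = μ ^ n * (μ⁻¹) ^ 2 * (A μ - lam * (μ ^ 2 * B μ)) := by
    rw [hB μ hμ]
    simp only [aux_grad]
    have : ∀ x, a x * ((μ⁻¹) ^ 2 * ‖gradient v (μ⁻¹ • (x - x₁))‖ ^ 2)
        = (μ⁻¹) ^ 2 * (a x * ‖gradient v (μ⁻¹ • (x - x₁))‖ ^ 2) := fun x => by ring
    simp only [this]
    rw [integral_const_mul, hA μ hμ]
    field_simp
  refine ⟨fun x => v (μ⁻¹ • (x - x₁)), hT, ?_, ?_, ?_⟩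
  · obtain ⟨y, hy⟩ := Function.ne_iff.1 hv0
    intro h
    apply hy
    have := congrFun h (x₁ + μ • y)
    simpa [inv_smul_smul₀ hμ.ne'] using this
  · rw [hnum]
    positivity
  · rw [hnum, hC μ hμ, aux_scale n hn p hp μ hμ _ hCμ.le, mul_div_mul_left _ _ (by positivity)]
    exact hQ

/-- with `κ^{a,c} = (min_{closure Θ} a^{n/2}/c^{(n−2)/2})·(1/n)·S^{n/2}`,
for every `λ` and every `ε > 0` there is a nonzero `u ∈ C_c^∞(Θ)` whose (positive)
quasi-energy quotient raised to `n/2` and divided by `n` is below `κ^{a,c} + ε`. -/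
theorem stmt_6 (n : ℕ) (hn : 3 ≤ n) (p : ℝ) (hp : p = 2 * (n : ℝ) / ((n : ℝ) - 2))
    (Θ : Set (EuclideanSpace ℝ (Fin n))) (hΘne : Θ.Nonempty) (hΘo : IsOpen Θ)
    (hΘb : Bornology.IsBounded Θ)
    (a b c : EuclideanSpace ℝ (Fin n) → ℝ)
    (ha : ContDiffOn ℝ 1 a (closure Θ)) (hb : ContinuousOn b (closure Θ))
    (hc : ContinuousOn c (closure Θ))
    (hapos : ∀ x ∈ closure Θ, 0 < a x) (hbpos : ∀ x ∈ closure Θ, 0 < b x)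
    (hcpos : ∀ x ∈ closure Θ, 0 < c x)
    (κ : ℝ)
    (hκ : κ = sInf ((fun x => a x ^ ((n : ℝ) / 2) / c x ^ (((n : ℝ) - 2) / 2)) '' closure Θ) *
          ((1 : ℝ) / n) * SobolevS n ^ ((n : ℝ) / 2)) :
    ∀ lam : ℝ, ∀ ε > (0 : ℝ), ∃ u : EuclideanSpace ℝ (Fin n) → ℝ,
      IsTestFun Θ u ∧ u ≠ 0 ∧
      0 < (∫ x in Θ, a x * ‖gradient u x‖ ^ 2) - lam * ∫ x in Θ, b x * u x ^ 2 ∧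
      (1 : ℝ) / n *
        (((∫ x in Θ, a x * ‖gradient u x‖ ^ 2) - lam * ∫ x in Θ, b x * u x ^ 2) /
            (∫ x in Θ, c x * |u x| ^ p) ^ (2 / p)) ^ ((n : ℝ) / 2) < κ + ε := by
  intro lam ε hε
  have hn' : (3 : ℝ) ≤ n := by exact_mod_cast hn
  have hn0 : (0 : ℝ) < n := by linarith
  have hn2 : (0 : ℝ) < (n : ℝ) - 2 := by linarith
  have hp0 : 0 < p := by rw [hp]; positivity
  set f : EuclideanSpace ℝ (Fin n) → ℝ :=
    fun x => a x ^ ((n : ℝ) / 2) / c x ^ (((n : ℝ) - 2) / 2) with hf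
  set m := sInf (f '' closure Θ) with hm
  have hfc : ContinuousOn f (closure Θ) := by
    refine ContinuousOn.div ?_ ?_ ?_
    · exact ha.continuousOn.rpow_const (fun x hx => Or.inl (hapos x hx).ne')
    · exact hc.rpow_const (fun x hx => Or.inl (hcpos x hx).ne')
    · intro x hx
      exact (Real.rpow_pos_of_pos (hcpos x hx) _).ne'
  -- choose v
  obtain ⟨r, ⟨v, hv, hv0, hr⟩, hvlt⟩ : ∃ r ∈ { r : ℝ | ∃ u : EuclideanSpace ℝ (Fin n) → ℝ,
      IsTestFun Set.univ u ∧ u ≠ 0 ∧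
      r = (∫ x, ‖gradient u x‖ ^ 2) /
        (∫ x, |u x| ^ (2 * (n : ℝ) / ((n : ℝ) - 2))) ^ (2 / (2 * (n : ℝ) / ((n : ℝ) - 2))) },
      m * ((1 : ℝ) / n) * r ^ ((n : ℝ) / 2) < κ + ε := by
    refine aux_inf _ ?_ ?_ (fun r => m * ((1 : ℝ) / n) * r ^ ((n : ℝ) / 2)) ?_ _ ?_
    · obtain ⟨v, hv, hv0⟩ := aux_exists_test n
      exact ⟨_, v, hv, hv0, rfl⟩
    · refine ⟨0, ?_⟩
      rintro r ⟨u, -, -, rfl⟩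
      have h1 : 0 ≤ ∫ x, ‖gradient u x‖ ^ 2 := integral_nonneg fun x => by positivity
      have h2 : 0 ≤ ∫ x, |u x| ^ (2 * (n : ℝ) / ((n : ℝ) - 2)) :=
        integral_nonneg fun x => by positivity
      positivity
    · exact continuous_const.mul (Real.continuous_rpow_const (by positivity))
    · change m * ((1 : ℝ) / n) * SobolevS n ^ ((n : ℝ) / 2) < κ + ε
      rw [← hκ]
      linarith
  rw [← hp] at hr
  -- choose x₀
  obtain ⟨-, ⟨x₀, hx₀, rfl⟩, hx₀lt⟩ : ∃ s ∈ f '' closure Θ,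
      s * ((1 : ℝ) / n) * r ^ ((n : ℝ) / 2) < κ + ε := by
    refine aux_inf _ (hΘne.closure.image f) ?_
      (fun s => s * ((1 : ℝ) / n) * r ^ ((n : ℝ) / 2)) (by fun_prop) _ hvlt
    refine ⟨0, ?_⟩
    rintro _ ⟨x, hx, rfl⟩
    have := hapos x hx
    have := hcpos x hx
    simp only [hf]
    positivity
  -- choose x₁
  obtain ⟨x₁, hx₁, hx₁lt⟩ : ∃ x ∈ Θ, f x * ((1 : ℝ) / n) * r ^ ((n : ℝ) / 2) < κ + ε := by
    have hfr : ∃ᶠ x in nhdsWithin x₀ (closure Θ), x ∈ Θ := by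
      have := mem_closure_iff_frequently.1 hx₀
      rw [Filter.frequently_iff] at this ⊢
      intro U hU
      obtain ⟨V, hV, hVU⟩ := mem_nhdsWithin_iff_exists_mem_nhds_inter.1 hU
      obtain ⟨x, h1, h2⟩ := this hV
      exact ⟨x, hVU ⟨h1, subset_closure h2⟩, h2⟩
    have hev : ∀ᶠ x in nhdsWithin x₀ (closure Θ),
        f x * ((1 : ℝ) / n) * r ^ ((n : ℝ) / 2) < κ + ε :=
      (((hfc x₀ hx₀).tendsto.mul_const _).mul_const _).eventually (gt_mem_nhds hx₀lt)
    exact (hfr.and_eventually hev).exists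
  exact aux_main n hn p hp Θ hΘo hΘb a b c ha.continuousOn hb hc hapos hcpos lam (κ + ε) r x₁ hx₁ v
    hv hv0 hr hx₁lt

end
end

section
/- Let n ≥ 3 and k ≥ 1 be integers and set 2* := 2n/(n−2). Let Θ be a nonempty bounded open subset of ℝⁿ whose closure is contained in (0,∞)×ℝ^{n−1}, and set α := min{x₁ : x ∈ closure(Θ)} and β := max{x₁ : x ∈ closure(Θ)}. Let S := inf{ (∫_{ℝⁿ}|∇u|²dx) / (∫_{ℝⁿ}|u|^{2*}dx)^{2/2*} : u ∈ C_c^∞(ℝⁿ), u ≠ 0 }. Assume β/α ≤ n/(n−2). Then for every λ ≤ k²/(4β²) and every u ∈ C_c^∞(Θ) with u ≠ 0, (∫_Θ x₁^k|∇u(x)|²dx − λ∫_Θ x₁^k u(x)²dx) / (∫_Θ x₁^k|u(x)|^{2*}dx)^{2/2*} ≥ α^{2k/n}·S. -/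
open MeasureTheory

noncomputable section

/-- The first coordinate `x₁` of `x ∈ ℝⁿ`. -/
def fstCoord (n : ℕ) (x : EuclideanSpace ℝ (Fin n)) : ℝ :=
  if h : 0 < n then x ⟨0, h⟩ else 0

lemma aux_low {α β t c : ℝ} {k : ℕ} (hα : 0 < α) (h1 : α ≤ t) (h2 : t ≤ β)
    (hc : c = (k : ℝ) / (2 * β)) :
    α ^ k * Real.exp (-(2 * c * α)) * Real.exp (c * t) ^ 2 ≤ t ^ k := by
  have ht : 0 < t := hα.trans_le h1
  have hβ : 0 < β := ht.trans_le h2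
  have hl : (t - α) / β ≤ Real.log (t / α) := by
    refine le_trans ?_ (Real.one_sub_inv_le_log_of_pos (div_pos ht hα))
    rw [inv_div, one_sub_div ht.ne']
    gcongr
  have he : α * Real.exp ((t - α) / β) ≤ t := by
    have := Real.exp_le_exp.2 hl
    rw [Real.exp_log (div_pos ht hα), le_div_iff₀ hα] at this
    linarith
  have hk := pow_le_pow_left₀ (by positivity) he k
  refine le_trans (le_of_eq ?_) hk
  rw [mul_pow, ← Real.exp_nat_mul, ← Real.exp_nat_mul, mul_assoc, ← Real.exp_add]
  congr 2
  rw [hc]; field_simp; push_cast; ring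

lemma aux_up {α t c p : ℝ} {k : ℕ} (hα : 0 < α) (h1 : α ≤ t)
    (hc : (k : ℝ) / α ≤ c * p) :
    t ^ k ≤ α ^ k * Real.exp (-(c * p * α)) * Real.exp (c * t) ^ p := by
  have ht : 0 < t := hα.trans_le h1
  have he : t ≤ α * Real.exp ((t - α) / α) := by
    have := Real.add_one_le_exp ((t - α) / α)
    have h3 : (t - α) / α + 1 = t / α := by field_simp; ring
    rw [h3, div_le_iff₀ hα] at this
    linarith
  have hk := pow_le_pow_left₀ ht.le he k
  refine hk.trans ?_
  rw [mul_pow, ← Real.exp_nat_mul, ← Real.exp_mul, mul_assoc, ← Real.exp_add]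
  gcongr
  have : (k : ℝ) * ((t - α) / α) = (k : ℝ) / α * (t - α) := by ring
  rw [this]
  have := mul_le_mul_of_nonneg_right hc (sub_nonneg.2 h1)
  linarith

lemma final_alg {α c p n' S N D Z G : ℝ} {k : ℕ} (hα : 0 < α) (hp0 : 0 < p) (hn : 0 < n')
    (hpn : 2 / p + 2 / n' = 1)
    (hS : 0 ≤ S) (hD : 0 < D) (hZ : 0 ≤ Z)
    (hN : α ^ k * Real.exp (-(2 * c * α)) * G ≤ N)
    (hG : S * Z ^ (2 / p) ≤ G)
    (hDZ : D ≤ α ^ k * Real.exp (-(c * p * α)) * Z) :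
    N / D ^ (2 / p) ≥ α ^ (2 * (k : ℝ) / n') * S := by
  rw [ge_iff_le, le_div_iff₀ (Real.rpow_pos_of_pos hD _)]
  have h1 : D ^ (2 / p) ≤ (α ^ k * Real.exp (-(c * p * α))) ^ (2 / p) * Z ^ (2 / p) := by
    rw [← Real.mul_rpow (by positivity) hZ]
    exact Real.rpow_le_rpow hD.le hDZ (by positivity)
  have h2 : α ^ (2 * (k : ℝ) / n') * (α ^ k * Real.exp (-(c * p * α))) ^ (2 / p)
      = α ^ k * Real.exp (-(2 * c * α)) := by
    rw [Real.mul_rpow (by positivity) (by positivity), ← Real.exp_mul, ← Real.rpow_natCast,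
      ← Real.rpow_mul hα.le, ← mul_assoc, ← Real.rpow_add hα]
    congr 2
    · have : 2 * (k : ℝ) / n' + k * (2 / p) = k * (2 / p + 2 / n') := by ring
      rw [this, hpn, mul_one]
    · field_simp
  calc α ^ (2 * (k : ℝ) / n') * S * D ^ (2 / p)
      ≤ α ^ (2 * (k : ℝ) / n') * S *
        ((α ^ k * Real.exp (-(c * p * α))) ^ (2 / p) * Z ^ (2 / p)) := by gcongr
    _ = (α ^ (2 * (k : ℝ) / n') * (α ^ k * Real.exp (-(c * p * α))) ^ (2 / p))
        * (S * Z ^ (2 / p)) := by ring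
    _ = α ^ k * Real.exp (-(2 * c * α)) * (S * Z ^ (2 / p)) := by rw [h2]
    _ ≤ α ^ k * Real.exp (-(2 * c * α)) * G := by gcongr
    _ ≤ N := hN

lemma grad_z {n : ℕ} (i : Fin n) (c : ℝ) (u : EuclideanSpace ℝ (Fin n) → ℝ)
    (hu : Differentiable ℝ u) (x : EuclideanSpace ℝ (Fin n)) :
    gradient (fun y => Real.exp (c * y i) * u y) x =
      Real.exp (c * x i) • (gradient u x + (c * u x) • EuclideanSpace.single i (1 : ℝ)) := by
  apply HasGradientAt.gradient
  rw [hasGradientAt_iff_hasFDerivAt]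
  have h1 : HasFDerivAt (fun y : EuclideanSpace ℝ (Fin n) => y i)
      (EuclideanSpace.proj i : EuclideanSpace ℝ (Fin n) →L[ℝ] ℝ) x :=
    (EuclideanSpace.proj i : EuclideanSpace ℝ (Fin n) →L[ℝ] ℝ).hasFDerivAt
  have h2 := ((h1.const_mul c).exp).mul (hu x).hasGradientAt.hasFDerivAt
  refine h2.congr_fderiv ?_
  ext y
  simp [inner_add_left, inner_smul_left, EuclideanSpace.inner_single_left]
  ring

lemma inner_grad {n : ℕ} (i : Fin n) (u : EuclideanSpace ℝ (Fin n) → ℝ)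
    (hu : Differentiable ℝ u) (x : EuclideanSpace ℝ (Fin n)) :
    fderiv ℝ u x (EuclideanSpace.single i (1 : ℝ)) =
      inner ℝ (gradient u x) (EuclideanSpace.single i (1 : ℝ)) := by
  rw [(hu x).hasGradientAt.hasFDerivAt.fderiv]
  simp

lemma norm_expand {n : ℕ} (i : Fin n) (E s d : ℝ) (g : EuclideanSpace ℝ (Fin n))
    (hd : d = inner ℝ g (EuclideanSpace.single i (1 : ℝ))) :
    ‖E • (g + s • EuclideanSpace.single i (1 : ℝ))‖ ^ 2
      = E ^ 2 * (‖g‖ ^ 2 + 2 * s * d + s ^ 2) := by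
  have h1 : ‖(EuclideanSpace.single i (1 : ℝ) : EuclideanSpace ℝ (Fin n))‖ = 1 := by simp
  rw [norm_smul, mul_pow, norm_add_sq_real, inner_smul_right, norm_smul, ← hd, h1, mul_one,
    Real.norm_eq_abs, Real.norm_eq_abs, sq_abs, sq_abs]
  ring

lemma ibp {n k : ℕ} (i : Fin n) (u : EuclideanSpace ℝ (Fin n) → ℝ)
    (hu : ContDiff ℝ (⊤ : ℕ∞) u) (hc : HasCompactSupport u) :
    ∫ x, ((k : ℝ) * (x i) ^ (k - 1) * u x ^ 2 +
      2 * (x i) ^ k * u x * fderiv ℝ u x (EuclideanSpace.single i (1 : ℝ))) = 0 := by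
  have hd : Differentiable ℝ u := hu.differentiable (by simp)
  have hcu : Continuous u := hu.continuous
  have hcd : Continuous (fun x => fderiv ℝ u x (EuclideanSpace.single i (1 : ℝ))) :=
    (hu.continuous_fderiv (by simp)).clm_apply continuous_const
  have hf : ∀ x : EuclideanSpace ℝ (Fin n), HasFDerivAt (fun y : EuclideanSpace ℝ (Fin n) => (y i) ^ k * u y)
      ((x i) ^ k • fderiv ℝ u x + u x • (((k : ℝ) * (x i) ^ (k - 1)) •
        (EuclideanSpace.proj i : EuclideanSpace ℝ (Fin n) →L[ℝ] ℝ))) x := by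
    intro x
    have h1 : HasFDerivAt (fun y : EuclideanSpace ℝ (Fin n) => y i)
      (EuclideanSpace.proj i : EuclideanSpace ℝ (Fin n) →L[ℝ] ℝ) x :=
      (EuclideanSpace.proj i : EuclideanSpace ℝ (Fin n) →L[ℝ] ℝ).hasFDerivAt
    have := (h1.pow k).mul (hd x).hasFDerivAt
    refine this.congr_fderiv ?_
    ext y; simp
  have hi1 : Integrable (fun x : EuclideanSpace ℝ (Fin n) => (x i) ^ k * u x * fderiv ℝ u x (EuclideanSpace.single i (1 : ℝ))) :=
    (by fun_prop : Continuous _).integrable_of_hasCompactSupport (hc.mul_left.mul_right)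
  have hi3 : Integrable (fun x : EuclideanSpace ℝ (Fin n) => (k : ℝ) * (x i) ^ (k - 1) * u x * u x) :=
    (by fun_prop : Continuous _).integrable_of_hasCompactSupport (hc.mul_left)
  have hi4 : Integrable (fun x : EuclideanSpace ℝ (Fin n) => (x i) ^ k * u x * u x) :=
    (by fun_prop : Continuous _).integrable_of_hasCompactSupport (hc.mul_left)
  have hfd : ∀ x : EuclideanSpace ℝ (Fin n), fderiv ℝ (fun y : EuclideanSpace ℝ (Fin n) => (y i) ^ k * u y) x
      (EuclideanSpace.single i (1 : ℝ)) =
      (x i) ^ k * fderiv ℝ u x (EuclideanSpace.single i (1 : ℝ)) + (k : ℝ) * (x i) ^ (k - 1) * u x := by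
    intro x; rw [(hf x).fderiv]; simp; ring
  have key := integral_mul_fderiv_eq_neg_fderiv_mul_of_integrable
    (μ := (volume : Measure (EuclideanSpace ℝ (Fin n)))) (𝕜 := ℝ)
    (f := fun y : EuclideanSpace ℝ (Fin n) => (y i) ^ k * u y) (g := u)
    (v := EuclideanSpace.single i (1 : ℝ))
    (by
      simp only [hfd]
      refine (hi1.add hi3).congr (Filter.Eventually.of_forall fun x => ?_)
      simp only [Pi.add_apply]; ring)
    hi1 hi4 (fun x _ => (hf x).differentiableAt) (fun x _ => hd x)
  simp only [hfd] at key
  have e1 : ∀ x : EuclideanSpace ℝ (Fin n), ((k : ℝ) * (x i) ^ (k - 1) * u x ^ 2 +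
      2 * (x i) ^ k * u x * fderiv ℝ u x (EuclideanSpace.single i (1 : ℝ))) =
      (x i) ^ k * u x * fderiv ℝ u x (EuclideanSpace.single i (1 : ℝ)) +
      ((x i) ^ k * fderiv ℝ u x (EuclideanSpace.single i (1 : ℝ)) + (k : ℝ) * (x i) ^ (k - 1) * u x) * u x := by
    intro x; ring
  simp only [e1]
  rw [integral_add hi1, key]
  · ring
  · refine (hi1.add hi3).congr (Filter.Eventually.of_forall fun x => ?_)
    simp only [Pi.add_apply]; ring

/-- if `β/α ≤ n/(n−2)`, then for every `λ ≤ k²/(4β²)` and every nonzero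
`u ∈ C_c^∞(Θ)`,
`(∫_Θ x₁^k|∇u|² − λ∫_Θ x₁^k u²)/(∫_Θ x₁^k|u|^{2*})^{2/2*} ≥ α^{2k/n}·S`. -/
theorem stmt_13 (n k : ℕ) (hn : 3 ≤ n) (hk : 1 ≤ k)
    (p : ℝ) (hp : p = 2 * (n : ℝ) / ((n : ℝ) - 2))
    (Θ : Set (EuclideanSpace ℝ (Fin n))) (hΘne : Θ.Nonempty) (hΘo : IsOpen Θ)
    (hΘb : Bornology.IsBounded Θ)
    (hΘpos : ∀ x ∈ closure Θ, 0 < fstCoord n x)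
    (α β : ℝ) (hα : α = sInf (fstCoord n '' closure Θ))
    (hβ : β = sSup (fstCoord n '' closure Θ))
    (hthin : β / α ≤ (n : ℝ) / ((n : ℝ) - 2)) :
    ∀ lam : ℝ, lam ≤ (k : ℝ) ^ 2 / (4 * β ^ 2) →
      ∀ u : EuclideanSpace ℝ (Fin n) → ℝ, IsTestFun Θ u → u ≠ 0 →
        ((∫ x in Θ, fstCoord n x ^ k * ‖gradient u x‖ ^ 2) -
            lam * ∫ x in Θ, fstCoord n x ^ k * u x ^ 2) /
          (∫ x in Θ, fstCoord n x ^ k * |u x| ^ p) ^ (2 / p) ≥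
        α ^ (2 * (k : ℝ) / (n : ℝ)) * SobolevS n := by
  intro lam hlam u hu hu0
  obtain ⟨hus, huc, husupp⟩ := hu
  have hn0 : 0 < n := by omega
  set i : Fin n := ⟨0, hn0⟩ with hi
  have hfst : ∀ x, fstCoord n x = x i := fun x => by simp [fstCoord, hn0, hi]
  have hfs : fstCoord n = fun x => x i := funext hfst
  have hcompact : IsCompact (fstCoord n '' closure Θ) := by
    refine hΘb.isCompact_closure.image ?_
    rw [hfs]; fun_prop
  have hne : (fstCoord n '' closure Θ).Nonempty := (hΘne.mono subset_closure).image _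
  have hα0 : 0 < α := by
    obtain ⟨x, hx, hxe⟩ := hcompact.sInf_mem hne
    rw [hα, ← hxe]; exact hΘpos x hx
  have hlow : ∀ x ∈ Θ, α ≤ x i := fun x hx => by
    rw [hα, ← hfst]
    exact csInf_le hcompact.bddBelow ⟨x, subset_closure hx, rfl⟩
  have hup : ∀ x ∈ Θ, x i ≤ β := fun x hx => by
    rw [hβ, ← hfst]
    exact le_csSup hcompact.bddAbove ⟨x, subset_closure hx, rfl⟩
  obtain ⟨x₀, hx₀⟩ := hΘne
  have hβ0 : 0 < β := hα0.trans_le ((hlow x₀ hx₀).trans (hup x₀ hx₀))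
  have hn3 : (3 : ℝ) ≤ n := by exact_mod_cast hn
  have hn2 : (0 : ℝ) < (n : ℝ) - 2 := by linarith
  have hnp : (0 : ℝ) < n := by linarith
  have hp0 : 0 < p := by rw [hp]; positivity
  have hpn : 2 / p + 2 / (n : ℝ) = 1 := by rw [hp]; field_simp; ring
  obtain ⟨c, hc⟩ : ∃ c : ℝ, c = (k : ℝ) / (2 * β) := ⟨_, rfl⟩
  have hc0 : 0 ≤ c := by rw [hc]; positivity
  have hcp : (k : ℝ) / α ≤ c * p := by
    have : c * p = (k : ℝ) / β * ((n : ℝ) / ((n : ℝ) - 2)) := by rw [hc, hp]; field_simp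
    rw [this]
    calc (k : ℝ) / α = (k : ℝ) / β * (β / α) := by field_simp
      _ ≤ _ := by gcongr
  have hlamc : lam ≤ c ^ 2 := by
    refine hlam.trans (le_of_eq ?_)
    rw [hc]; field_simp; norm_num
  have hout : ∀ x, x ∉ Θ → u x = 0 := fun x hx =>
    image_eq_zero_of_notMem_tsupport fun h => hx (husupp h)
  have hgout : ∀ x, x ∉ Θ → fderiv ℝ u x = 0 := fun x hx =>
    fderiv_of_notMem_tsupport ℝ (fun h => hx (husupp h))
  have hd : Differentiable ℝ u := hus.differentiable (by simp)
  have hcu : Continuous u := hus.continuous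
  have hcf : Continuous (fderiv ℝ u) := hus.continuous_fderiv (by simp)
  have hcg : Continuous (gradient u) :=
    (InnerProductSpace.toDual ℝ (EuclideanSpace ℝ (Fin n))).symm.continuous.comp hcf
  have hg0 : ∀ x, x ∉ Θ → gradient u x = 0 := fun x hx => by
    simp [gradient, hgout x hx]
  have hgc : HasCompactSupport (gradient u) :=
    (huc.fderiv (𝕜 := ℝ)).comp_left (g := (InnerProductSpace.toDual ℝ (EuclideanSpace ℝ (Fin n))).symm)
      (map_zero _)
  simp only [hfst]
  have hp1 : 0 ≤ p := hp0.le
  -- set integrals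
  rw [setIntegral_eq_integral_of_forall_compl_eq_zero (fun x hx => by simp [hg0 x hx]),
    setIntegral_eq_integral_of_forall_compl_eq_zero (fun x hx => by simp [hout x hx]),
    setIntegral_eq_integral_of_forall_compl_eq_zero
      (fun x hx => by simp [hout x hx, Real.zero_rpow hp0.ne'])]
  obtain ⟨z, hz⟩ : ∃ z : EuclideanSpace ℝ (Fin n) → ℝ,
    z = fun x => Real.exp (c * x i) * u x := ⟨_, rfl⟩
  have hzs : ContDiff ℝ (⊤ : ℕ∞) z := by
    rw [hz]; exact (by fun_prop : ContDiff ℝ (⊤ : ℕ∞) fun x : EuclideanSpace ℝ (Fin n) => Real.exp (c * x i)).mul hus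
  have hzc : HasCompactSupport z := by rw [hz]; exact huc.mul_left
  have hz0 : z ≠ 0 := by
    intro h
    apply hu0
    funext x
    have := congrFun h x
    simpa [hz] using this
  have hcz : Continuous z := hzs.continuous
  have hgz : ∀ x, ‖gradient z x‖ ^ 2 = Real.exp (c * x i) ^ 2 * (‖gradient u x‖ ^ 2
      + 2 * (c * u x) * fderiv ℝ u x (EuclideanSpace.single i (1 : ℝ)) + (c * u x) ^ 2) := by
    intro x
    rw [hz, grad_z i c u hd x]
    exact norm_expand i _ _ _ _ (inner_grad i u hd x)
  have hcd : Continuous (fun x => fderiv ℝ u x (EuclideanSpace.single i (1 : ℝ))) :=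
    hcf.clm_apply continuous_const
  have hcabs : Continuous fun x => |u x| ^ p :=
    hcu.abs.rpow_const fun x => Or.inr hp1
  have hczabs : Continuous fun x => |z x| ^ p :=
    hcz.abs.rpow_const fun x => Or.inr hp1
  have hcsu : HasCompactSupport fun x => |u x| ^ p :=
    huc.comp_left (g := fun r : ℝ => |r| ^ p) (by simp [Real.zero_rpow hp0.ne'])
  have hcsz : HasCompactSupport fun x => |z x| ^ p :=
    hzc.comp_left (g := fun r : ℝ => |r| ^ p) (by simp [Real.zero_rpow hp0.ne'])
  have hcsu2 : HasCompactSupport fun x => u x ^ 2 :=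
    huc.comp_left (g := fun r : ℝ => r ^ 2) (by simp)
  have hcsg2 : HasCompactSupport fun x => ‖gradient u x‖ ^ 2 :=
    hgc.comp_left (g := fun r => ‖r‖ ^ 2) (by simp)
  have hSbdd : ∀ r ∈ { r : ℝ | ∃ u : EuclideanSpace ℝ (Fin n) → ℝ,
    IsTestFun Set.univ u ∧ u ≠ 0 ∧
    r = (∫ x, ‖gradient u x‖ ^ 2) /
        (∫ x, |u x| ^ (2 * (n : ℝ) / ((n : ℝ) - 2))) ^ (2 / (2 * (n : ℝ) / ((n : ℝ) - 2))) }, 0 ≤ r := by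
    rintro r ⟨v, -, -, rfl⟩
    exact div_nonneg (integral_nonneg fun x => by positivity)
      (Real.rpow_nonneg (integral_nonneg fun x => by positivity) _)
  have hS : 0 ≤ SobolevS n := Real.sInf_nonneg hSbdd
  have hSle : SobolevS n ≤ (∫ x, ‖gradient z x‖ ^ 2) / (∫ x, |z x| ^ p) ^ (2 / p) := by
    refine csInf_le ⟨0, hSbdd⟩ ⟨z, ⟨hzs, hzc, Set.subset_univ _⟩, hz0, ?_⟩
    rw [hp]
  have hZ : 0 < ∫ x, |z x| ^ p := by
    obtain ⟨x, hx⟩ := Function.ne_iff.1 hz0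
    refine hczabs.integral_pos_of_hasCompactSupport_nonneg_nonzero hcsz
      (fun x => by positivity) (x := x) ?_
    exact (Real.rpow_pos_of_pos (abs_pos.2 hx) p).ne'
  have hcD : Continuous fun x : EuclideanSpace ℝ (Fin n) => (x i) ^ k * |u x| ^ p := by fun_prop
  have hD : 0 < ∫ x : EuclideanSpace ℝ (Fin n), (x i) ^ k * |u x| ^ p := by
    obtain ⟨x, hx⟩ := Function.ne_iff.1 hu0
    refine hcD.integral_pos_of_hasCompactSupport_nonneg_nonzero hcsu.mul_left
      (fun x => ?_) (x := x) ?_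
    · by_cases h : x ∈ Θ
      · have := hα0.trans_le (hlow x h)
        positivity
      · simp [hout x h, Real.zero_rpow hp0.ne']
    · have h : x ∈ Θ := by
        by_contra h
        exact hx (hout x h)
      have h1 := hα0.trans_le (hlow x h)
      have h2 := Real.rpow_pos_of_pos (abs_pos.2 hx) p
      exact (mul_pos (pow_pos h1 k) h2).ne'
  have hI2 : Integrable fun x : EuclideanSpace ℝ (Fin n) => (x i) ^ k * u x ^ 2 :=
    (by fun_prop : Continuous _).integrable_of_hasCompactSupport hcsu2.mul_left
  have hI1 : Integrable fun x : EuclideanSpace ℝ (Fin n) => (x i) ^ k * ‖gradient u x‖ ^ 2 :=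
    (by fun_prop : Continuous _).integrable_of_hasCompactSupport hcsg2.mul_left
  have hI3 : Integrable fun x : EuclideanSpace ℝ (Fin n) => ((k : ℝ) * (x i) ^ (k - 1) * u x ^ 2 +
      2 * (x i) ^ k * u x * fderiv ℝ u x (EuclideanSpace.single i (1 : ℝ))) :=
    (by fun_prop : Continuous _).integrable_of_hasCompactSupport
      (hcsu2.mul_left.add (huc.mul_left.mul_right))
  have hIz : Integrable fun x => ‖gradient z x‖ ^ 2 := by
    have hczg : Continuous (gradient z) :=
      (InnerProductSpace.toDual ℝ (EuclideanSpace ℝ (Fin n))).symm.continuous.comp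
        (hzs.continuous_fderiv (by simp))
    have hgzc : HasCompactSupport (gradient z) :=
      (hzc.fderiv (𝕜 := ℝ)).comp_left
        (g := (InnerProductSpace.toDual ℝ (EuclideanSpace ℝ (Fin n))).symm) (map_zero _)
    exact (by fun_prop : Continuous _).integrable_of_hasCompactSupport
      (hgzc.comp_left (g := fun r => ‖r‖ ^ 2) (by simp))
  refine final_alg (c := c) (Z := ∫ x, |z x| ^ p) (G := ∫ x, ‖gradient z x‖ ^ 2)
    hα0 hp0 hnp hpn hS hD hZ.le ?_ ?_ ?_
  · have hnn : 0 ≤ ∫ x : EuclideanSpace ℝ (Fin n), (x i) ^ k * u x ^ 2 := by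
      refine integral_nonneg fun x => ?_
      by_cases h : x ∈ Θ
      · have := hα0.trans_le (hlow x h)
        positivity
      · simp [hout x h]
    have h0 := ibp (k := k) i u hus huc
    have hmain : ∫ x, α ^ k * Real.exp (-(2 * c * α)) * ‖gradient z x‖ ^ 2 ≤
        ∫ x : EuclideanSpace ℝ (Fin n), (((x i) ^ k * ‖gradient u x‖ ^ 2 - c ^ 2 * ((x i) ^ k * u x ^ 2)) +
          c * ((k : ℝ) * (x i) ^ (k - 1) * u x ^ 2 +
      2 * (x i) ^ k * u x * fderiv ℝ u x (EuclideanSpace.single i (1 : ℝ)))) := by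
      refine integral_mono (hIz.const_mul _)
        ((hI1.sub (hI2.const_mul _)).add (hI3.const_mul _)) fun x => ?_
      by_cases h : x ∈ Θ
      · have ht := hα0.trans_le (hlow x h)
        have hA := aux_low hα0 (hlow x h) (hup x h) hc
        have hQ : 0 ≤ ‖gradient u x‖ ^ 2
          + 2 * (c * u x) * fderiv ℝ u x (EuclideanSpace.single i (1 : ℝ)) + (c * u x) ^ 2 := by
          have h5 := norm_expand i 1 (c * u x) _ _ (inner_grad i u hd x)
          rw [one_pow, one_mul] at h5
          rw [← h5]; positivity
        have hB := mul_le_mul_of_nonneg_right hA hQ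
        have hC : 2 * c * (x i) ^ k ≤ k * (x i) ^ (k - 1) := by
          obtain ⟨j, rfl⟩ : ∃ j, k = j + 1 := ⟨k - 1, by omega⟩
          rw [Nat.add_sub_cancel, pow_succ]
          have : 2 * c * x i ≤ ((j + 1 : ℕ) : ℝ) := by
            rw [hc]
            have : 2 * (((j + 1 : ℕ) : ℝ) / (2 * β)) * x i = ((j + 1 : ℕ) : ℝ) * (x i / β) := by
              field_simp
            rw [this]
            exact mul_le_of_le_one_right (by positivity) ((div_le_one hβ0).2 (hup x h))
          calc 2 * c * ((x i) ^ j * x i) = (2 * c * x i) * (x i) ^ j := by ring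
            _ ≤ _ := by gcongr
        have hC' := mul_le_mul_of_nonneg_left hC (mul_nonneg hc0 (sq_nonneg (u x)))
        simp only [hgz]
        linarith
      · simp [hgz, hout x h, hg0 x h]
    have hsub : Integrable fun x : EuclideanSpace ℝ (Fin n) =>
        (x i) ^ k * ‖gradient u x‖ ^ 2 - c ^ 2 * ((x i) ^ k * u x ^ 2) := hI1.sub (hI2.const_mul _)
    rw [integral_const_mul, integral_add hsub (hI3.const_mul _),
      integral_sub hI1 (hI2.const_mul _), integral_const_mul, integral_const_mul, h0] at hmain
    have := mul_le_mul_of_nonneg_right hlamc hnn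
    linarith
  · rwa [le_div_iff₀ (Real.rpow_pos_of_pos hZ _)] at hSle
  · rw [← integral_const_mul]
    refine integral_mono (hcD.integrable_of_hasCompactSupport hcsu.mul_left)
      ((hczabs.integrable_of_hasCompactSupport hcsz).const_mul _) fun x => ?_
    by_cases h : x ∈ Θ
    · have hU := aux_up hα0 (hlow x h) hcp
      have : |z x| ^ p = Real.exp (c * x i) ^ p * |u x| ^ p := by
        rw [hz, abs_mul, Real.mul_rpow (abs_nonneg _) (abs_nonneg _), abs_of_pos (Real.exp_pos _)]
      simp only [this]
      rw [← mul_assoc]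
      exact mul_le_mul_of_nonneg_right hU (by positivity)
    · simp [hz, hout x h, Real.zero_rpow hp0.ne']

end
end
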